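/- arXiv:2407.19170 — 5 statements merged into one kernel-verified Lean document; each statement's English description precedes it below -/
import Mathlib

section
/- Let U be an open subset of ℝ² with coordinates (y, s), let φ, ρ : U → ℝ be smooth, let λ ∈ ℝ, set D = (λ − φ)² − 4ρ, and assume D > 0 on U. Suppose that ∂s φ = ∂y(D^{−1/2}) and ∂s ρ = ∂y((λ − φ)/(2√D)) on U. Then ∂s(D^{−1/2}) = (((λ − φ)² + 4ρ)·∂y φ + 4(λ − φ)·∂y ρ) / D³ on U. -/
/-- The derivative of `1 / √((c - f)² - 4g)` along a line. -/
lemma hasDerivAt_one_div_sqrt_discrim {f g : ℝ → ℝ} {f' g' c x : ℝ}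
    (hf : HasDerivAt f f' x) (hg : HasDerivAt g g' x) (hpos : 0 < (c - f x) ^ 2 - 4 * g x) :
    HasDerivAt (fun t => 1 / Real.sqrt ((c - f t) ^ 2 - 4 * g t))
      (((c - f x) * f' + 2 * g') / Real.sqrt ((c - f x) ^ 2 - 4 * g x) ^ 3) x := by
  have hr := Real.sqrt_pos.mpr hpos
  have hd := (((hf.const_sub c).fun_pow 2).fun_sub (hg.const_mul 4)).sqrt hpos.ne'
  simp only [one_div]
  refine (hd.fun_inv hr.ne').congr_deriv ?_
  push_cast
  field_simp
  ring


/-- Lemma 3 of the paper (third formula), for a single derivation `∂s` at a fixed value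
of the parameter `λ`: given `∂s φ = ∂y(D^{−1/2})` and `∂s ρ = ∂y((λ − φ)/(2√D))` with
`D = (λ − φ)² − 4ρ > 0`, one has
`∂s(D^{−1/2}) = (((λ − φ)² + 4ρ)·∂y φ + 4(λ − φ)·∂y ρ)/D³` on `U`. -/
theorem gue_loop_lemma3_third
    (U : Set (ℝ × ℝ)) (hU : IsOpen U)
    (φ ρ : ℝ → ℝ → ℝ)
    (hφ : ContDiffOn ℝ (⊤ : ℕ∞) (fun p : ℝ × ℝ => φ p.1 p.2) U)
    (hρ : ContDiffOn ℝ (⊤ : ℕ∞) (fun p : ℝ × ℝ => ρ p.1 p.2) U)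
    (lam : ℝ) (D : ℝ → ℝ → ℝ)
    (hD : D = fun y s => (lam - φ y s) ^ 2 - 4 * ρ y s)
    (hDpos : ∀ y s : ℝ, (y, s) ∈ U → 0 < D y s)
    (h1 : ∀ y s : ℝ, (y, s) ∈ U →
      deriv (fun s' => φ y s') s = deriv (fun y' => 1 / Real.sqrt (D y' s)) y)
    (h2 : ∀ y s : ℝ, (y, s) ∈ U →
      deriv (fun s' => ρ y s') s
        = deriv (fun y' => (lam - φ y' s) / (2 * Real.sqrt (D y' s))) y) :
    ∀ y s : ℝ, (y, s) ∈ U →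
      deriv (fun s' => 1 / Real.sqrt (D y s')) s
        = (((lam - φ y s) ^ 2 + 4 * ρ y s) * deriv (fun y' => φ y' s) y
            + 4 * (lam - φ y s) * deriv (fun y' => ρ y' s) y) / (D y s) ^ 3 := by
  subst hD
  intro y s hys
  have hpos : 0 < (lam - φ y s) ^ 2 - 4 * ρ y s := hDpos y s hys
  have hUnhds := hU.mem_nhds hys
  have diff_fst {f : ℝ → ℝ → ℝ} (hf : ContDiffOn ℝ (⊤ : ℕ∞) (fun p : ℝ × ℝ => f p.1 p.2) U) :
      DifferentiableAt ℝ (fun y' => f y' s) y :=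
    ((hf.contDiffAt hUnhds).differentiableAt (by simp)).comp y
      (f := fun y' : ℝ => (y', s)) (by fun_prop)
  have diff_snd {f : ℝ → ℝ → ℝ} (hf : ContDiffOn ℝ (⊤ : ℕ∞) (fun p : ℝ × ℝ => f p.1 p.2) U) :
      DifferentiableAt ℝ (fun s' => f y s') s :=
    ((hf.contDiffAt hUnhds).differentiableAt (by simp)).comp s
      (f := fun s' : ℝ => (y, s')) (by fun_prop)
  have hφy := (diff_fst hφ).hasDerivAt
  have hy := hasDerivAt_one_div_sqrt_discrim hφy (diff_fst hρ).hasDerivAt hpos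
  have hs := hasDerivAt_one_div_sqrt_discrim (diff_snd hφ).hasDerivAt
    (diff_snd hρ).hasDerivAt hpos
  have hquot : (fun y' => (lam - φ y' s) / (2 * Real.sqrt ((lam - φ y' s) ^ 2 - 4 * ρ y' s)))
      = fun y' => (lam - φ y' s) / 2 * (1 / Real.sqrt ((lam - φ y' s) ^ 2 - 4 * ρ y' s)) := by
    funext y'
    rw [div_mul_div_comm, mul_one]
  have hφs := h1 y s hys
  have hρs := h2 y s hys
  simp only at hφs hρs ⊢
  rw [hy.deriv] at hφs
  rw [hquot, (((hφy.const_sub lam).div_const 2).fun_mul hy).deriv] at hρs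
  rw [hs.deriv, hφs, hρs]
  have hr := Real.sqrt_pos.mpr hpos
  have hsq := Real.sq_sqrt hpos.le
  set r := Real.sqrt ((lam - φ y s) ^ 2 - 4 * ρ y s)
  have hsum : (lam - φ y s) ^ 2 + 4 * ρ y s = 2 * (lam - φ y s) ^ 2 - r ^ 2 := by
    rw [hsq]
    ring
  rw [hsum, ← hsq]
  field_simp
  ring
end

section
/- Let U be an open subset of ℝ² with coordinates (y, s), let φ, ρ : U → ℝ be smooth, let λ ∈ ℝ, set D = (λ − φ)² − 4ρ, and assume D > 0 on U. Suppose that ∂s φ = ∂y(D^{−1/2}) and ∂s ρ = ∂y((λ − φ)/(2√D)) on U. Then ∂s((φ − λ)/√D) = (−8ρ(λ − φ)·∂y φ − (8ρ + 2(λ − φ)²)·∂y ρ) / D³ on U. -/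
theorem hasDerivAt_discriminant {f r : ℝ → ℝ} {a b x : ℝ} (lam : ℝ)
    (hf : HasDerivAt f a x) (hr : HasDerivAt r b x) :
    HasDerivAt (fun t => (lam - f t) ^ 2 - 4 * r t) (-2 * (lam - f x) * a - 4 * b) x := by
  refine (((hf.const_sub lam).pow 2).sub (hr.const_mul 4)).congr_deriv ?_
  norm_num

theorem hasDerivAt_div_sqrt {f g : ℝ → ℝ} {a b x : ℝ}
    (hf : HasDerivAt f a x) (hg : HasDerivAt g b x) (hpos : 0 < g x) :
    HasDerivAt (fun t => f t / √(g t)) (a / √(g x) - f x * b / (2 * √(g x) ^ 3)) x := by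
  have hw : √(g x) ≠ 0 := (Real.sqrt_pos.mpr hpos).ne'
  refine (hf.div (hg.sqrt hpos.ne') hw).congr_deriv ?_
  field_simp

/-- Lemma 3 of the paper (fourth formula), for a single derivation `∂s` at a fixed value
of the parameter `λ`: given `∂s φ = ∂y(D^{−1/2})` and `∂s ρ = ∂y((λ − φ)/(2√D))` with
`D = (λ − φ)² − 4ρ > 0`, one has
`∂s((φ − λ)/√D) = (−8ρ(λ − φ)·∂y φ − (8ρ + 2(λ − φ)²)·∂y ρ)/D³` on `U`. -/
theorem gue_loop_lemma3_fourth
    (U : Set (ℝ × ℝ)) (hU : IsOpen U)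
    (φ ρ : ℝ → ℝ → ℝ)
    (hφ : ContDiffOn ℝ (⊤ : ℕ∞) (fun p : ℝ × ℝ => φ p.1 p.2) U)
    (hρ : ContDiffOn ℝ (⊤ : ℕ∞) (fun p : ℝ × ℝ => ρ p.1 p.2) U)
    (lam : ℝ) (D : ℝ → ℝ → ℝ)
    (hD : D = fun y s => (lam - φ y s) ^ 2 - 4 * ρ y s)
    (hDpos : ∀ y s : ℝ, (y, s) ∈ U → 0 < D y s)
    (h1 : ∀ y s : ℝ, (y, s) ∈ U →
      deriv (fun s' => φ y s') s = deriv (fun y' => 1 / Real.sqrt (D y' s)) y)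
    (h2 : ∀ y s : ℝ, (y, s) ∈ U →
      deriv (fun s' => ρ y s') s
        = deriv (fun y' => (lam - φ y' s) / (2 * Real.sqrt (D y' s))) y) :
    ∀ y s : ℝ, (y, s) ∈ U →
      deriv (fun s' => (φ y s' - lam) / Real.sqrt (D y s')) s
        = (-8 * ρ y s * (lam - φ y s) * deriv (fun y' => φ y' s) y
            - (8 * ρ y s + 2 * (lam - φ y s) ^ 2) * deriv (fun y' => ρ y' s) y)
          / (D y s) ^ 3 := by
  intro y s hys
  subst hD
  beta_reduce at *
  have hnhds := hU.mem_nhds hys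
  have hy : DifferentiableAt ℝ (fun y' : ℝ => (y', s)) y := by fun_prop
  have hs : DifferentiableAt ℝ (fun s' : ℝ => (y, s')) s := by fun_prop
  have hφd := (hφ.contDiffAt hnhds).differentiableAt (by simp)
  have hρd := (hρ.contDiffAt hnhds).differentiableAt (by simp)
  have hφy : DifferentiableAt ℝ (fun y' => φ y' s) y := hφd.comp (f := fun y' => (y', s)) y hy
  have hρy : DifferentiableAt ℝ (fun y' => ρ y' s) y := hρd.comp (f := fun y' => (y', s)) y hy
  have hφs : DifferentiableAt ℝ (fun s' => φ y s') s := hφd.comp (f := fun s' => (y, s')) s hs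
  have hρs : DifferentiableAt ℝ (fun s' => ρ y s') s := hρd.comp (f := fun s' => (y, s')) s hs
  have hpos := hDpos y s hys
  have hDy := hasDerivAt_discriminant lam hφy.hasDerivAt hρy.hasDerivAt
  have hDs := hasDerivAt_discriminant lam hφs.hasDerivAt hρs.hasDerivAt
  have e1 := h1 y s hys
  have e2 := h2 y s hys
  have hu := (hφy.hasDerivAt.const_sub lam).div_const 2
  simp only [← div_div] at e2
  rw [(hasDerivAt_div_sqrt (hasDerivAt_const y (1 : ℝ)) hDy hpos).deriv] at e1
  rw [(hasDerivAt_div_sqrt hu hDy hpos).deriv] at e2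
  rw [(hasDerivAt_div_sqrt (hφs.hasDerivAt.sub_const lam) hDs hpos).deriv]
  rw [e2, e1]
  have hw := Real.sqrt_pos.mpr hpos
  have hsq := Real.sq_sqrt hpos.le
  generalize √((lam - φ y s) ^ 2 - 4 * ρ y s) = w at *
  rw [← hsq]
  have hρw : ρ y s = ((lam - φ y s) ^ 2 - w ^ 2) / 4 := by linarith
  rw [hρw]
  field_simp
  ring
end

section
/- Let λ ∈ ℝ and let U = {(φ, ρ) ∈ ℝ² : (φ − λ)² − 4ρ > 0}. On U define p₁(φ, ρ) = ½√((φ − λ)² − 4ρ) and p₂(φ, ρ) = φ − λ, and define the matrix-valued function g − λη = [[2, φ − λ], [φ − λ, 2ρ]] (rows/columns indexed by the coordinates φ, ρ). Then for the bilinear form (df, dh) := Σ_{α,β} (g − λη)^{αβ} ∂_α f ∂_β h on U one has identically: (dp₁, dp₁) = −1/2, (dp₁, dp₂) = 0, and (dp₂, dp₂) = 2. In other words, p₁ and p₂ are flat coordinates for the pencil g − λη with constant Gram matrix diag(−1/2, 2), the inverse of the matrix G = diag(−2, 1/2). -/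
/-- Partial derivative in the direction indexed by `Fin 2` (0 ↦ first slot φ,
1 ↦ second slot ρ) of a function of two real variables. -/
noncomputable def pd2 : Fin 2 → (ℝ → ℝ → ℝ) → ℝ → ℝ → ℝ := fun i f =>
  if i = 0 then fun φ ρ => deriv (fun φ' => f φ' ρ) φ
  else fun φ ρ => deriv (fun ρ' => f φ ρ') ρ

/-- The λ-period p₁(φ, ρ) = ½√((φ − λ)² − 4ρ) of the NLS Frobenius manifold. -/
noncomputable def periodp1 (lam : ℝ) : ℝ → ℝ → ℝ :=
  fun φ ρ => Real.sqrt ((φ - lam) ^ 2 - 4 * ρ) / 2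

/-- The λ-period p₂(φ, ρ) = φ − λ of the NLS Frobenius manifold. -/
def periodp2 (lam : ℝ) : ℝ → ℝ → ℝ := fun φ _ => φ - lam

theorem pd2_zero_periodp1 {lam φ ρ : ℝ} (h : 0 < (φ - lam) ^ 2 - 4 * ρ) :
    pd2 0 (periodp1 lam) φ ρ = (φ - lam) / (2 * √((φ - lam) ^ 2 - 4 * ρ)) := by
  have hD : HasDerivAt (fun x : ℝ => (x - lam) ^ 2 - 4 * ρ) (2 * (φ - lam)) φ := by
    simpa using (((hasDerivAt_id φ).sub_const lam).pow 2).sub_const (4 * ρ)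
  have hp := ((hD.sqrt h.ne').div_const 2).deriv
  simp only [pd2, periodp1, if_true]
  rw [hp]
  ring

theorem pd2_one_periodp1 {lam φ ρ : ℝ} (h : 0 < (φ - lam) ^ 2 - 4 * ρ) :
    pd2 1 (periodp1 lam) φ ρ = -1 / √((φ - lam) ^ 2 - 4 * ρ) := by
  have hD : HasDerivAt (fun y : ℝ => (φ - lam) ^ 2 - 4 * y) (-4) ρ := by
    simpa using ((hasDerivAt_id ρ).const_mul 4).const_sub ((φ - lam) ^ 2)
  have hp := ((hD.sqrt h.ne').div_const 2).deriv
  simp only [pd2, periodp1, one_ne_zero, if_false]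
  rw [hp]
  ring

theorem pd2_zero_periodp2 (lam φ ρ : ℝ) : pd2 0 (periodp2 lam) φ ρ = 1 := by
  simp [pd2, periodp2]

theorem pd2_one_periodp2 (lam φ ρ : ℝ) : pd2 1 (periodp2 lam) φ ρ = 0 := by
  simp [pd2, periodp2]

/-- The λ-periods p₁, p₂ are flat coordinates for the pencil
g − λη = [[2, φ−λ], [φ−λ, 2ρ]] with constant Gram matrix diag(−1/2, 2):
on U = {(φ,ρ) : (φ−λ)² − 4ρ > 0}, (dp_i, dp_j) = diag(−1/2, 2)_{ij} for the bilinear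
form (df, dh) = Σ_{α,β} (g − λη)^{αβ} ∂_α f ∂_β h. -/
theorem nls_periods_flat (lam : ℝ) (φ ρ : ℝ) (h : 0 < (φ - lam) ^ 2 - 4 * ρ)
    (i j : Fin 2) :
    (∑ α : Fin 2, ∑ β : Fin 2,
        !![(2 : ℝ), φ - lam; φ - lam, 2 * ρ] α β
          * pd2 α (![periodp1 lam, periodp2 lam] i) φ ρ
          * pd2 β (![periodp1 lam, periodp2 lam] j) φ ρ)
      = !![-(1 / 2 : ℝ), 0; 0, 2] i j := by
  have hs : √((φ - lam) ^ 2 - 4 * ρ) ≠ 0 := (Real.sqrt_pos.2 h).ne'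
  have hsq : √((φ - lam) ^ 2 - 4 * ρ) ^ 2 = (φ - lam) ^ 2 - 4 * ρ := Real.sq_sqrt h.le
  fin_cases i <;> fin_cases j <;>
    simp [Fin.sum_univ_two, pd2_zero_periodp1 h, pd2_one_periodp1 h, pd2_zero_periodp2,
      pd2_one_periodp2] <;>
    generalize √((φ - lam) ^ 2 - 4 * ρ) = s at hs hsq ⊢ <;>
    field_simp <;> linarith
end

section
/- Let F(φ, ρ) = ½φ²ρ + ½ρ²·log ρ − ¾ρ² on {(φ, ρ) ∈ ℝ² : ρ > 0}, let η = [[0,1],[1,0]] with inverse η^{−1} = η, let c_{αβγ} = ∂_α∂_β∂_γ F (indices 1 = φ, 2 = ρ), and let E¹ = φ, E² = 2ρ. Then the matrix g^{αβ} := Σ_{γ,μ,ν} E^γ η^{αμ} η^{βν} c_{γμν} equals [[2, φ], [φ, 2ρ]] identically on {ρ > 0}. -/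
/-- The potential F(φ, ρ) = ½φ²ρ + ½ρ² log ρ − ¾ρ² of the NLS Frobenius manifold. -/
noncomputable def Fnls : ℝ → ℝ → ℝ := fun φ ρ =>
  φ ^ 2 * ρ / 2 + ρ ^ 2 * Real.log ρ / 2 - 3 * ρ ^ 2 / 4

/-- The Euler vector field components E¹ = φ, E² = 2ρ. -/
def Enls : Fin 2 → ℝ → ℝ → ℝ := fun γ =>
  if γ = 0 then fun φ _ => φ else fun _ ρ => 2 * ρ

/-- The flat metric η = [[0,1],[1,0]] (equal to its inverse η⁻¹). -/
def ηnls : Fin 2 → Fin 2 → ℝ := fun α β => if α = β then 0 else 1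

theorem pd2_zero_eq {f : ℝ → ℝ → ℝ} {φ ρ d : ℝ} (h : HasDerivAt (fun x => f x ρ) d φ) :
    pd2 0 f φ ρ = d := by
  simpa [pd2] using h.deriv

theorem pd2_one_eq {f : ℝ → ℝ → ℝ} {φ ρ d : ℝ} (h : HasDerivAt (fun y => f φ y) d ρ) :
    pd2 1 f φ ρ = d := by
  simpa [pd2] using h.deriv

/-- Partial derivatives on the half plane `ρ > 0` depend only on the values there. -/
theorem pd2_congr {f g : ℝ → ℝ → ℝ} (h : ∀ φ ρ : ℝ, 0 < ρ → f φ ρ = g φ ρ) (i : Fin 2)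
    {φ ρ : ℝ} (hρ : 0 < ρ) : pd2 i f φ ρ = pd2 i g φ ρ := by
  fin_cases i
  · simp [pd2, h _ ρ hρ]
  · have : (fun y => f φ y) =ᶠ[nhds ρ] fun y => g φ y := by
      filter_upwards [lt_mem_nhds hρ] with y hy using h φ y hy
    simpa [pd2] using this.deriv_eq

theorem pd2_zero_Fnls (φ ρ : ℝ) : pd2 0 Fnls φ ρ = φ * ρ := by
  apply pd2_zero_eq
  have h := ((((hasDerivAt_id φ).pow 2).mul_const ρ).div_const 2).add_const
    (ρ ^ 2 * Real.log ρ / 2) |>.sub_const (3 * ρ ^ 2 / 4)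
  refine h.congr_deriv ?_
  simp
  ring

theorem pd2_one_Fnls (φ : ℝ) {ρ : ℝ} (hρ : 0 < ρ) :
    pd2 1 Fnls φ ρ = φ ^ 2 / 2 + ρ * Real.log ρ - ρ := by
  apply pd2_one_eq
  have hid := hasDerivAt_id ρ
  have h := (((hid.const_mul (φ ^ 2)).div_const 2).add
    (((hid.pow 2).mul (Real.hasDerivAt_log hρ.ne')).div_const 2)).sub
    (((hid.pow 2).const_mul 3).div_const 4)
  refine h.congr_deriv ?_
  simp
  field_simp
  ring

/-- The Hessian of `Fnls` on `ρ > 0` is `[[ρ, φ], [φ, log ρ]]`. -/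
theorem pd2_pd2_Fnls (μ ν : Fin 2) (φ : ℝ) {ρ : ℝ} (hρ : 0 < ρ) :
    pd2 μ (pd2 ν Fnls) φ ρ = !![ρ, φ; φ, Real.log ρ] μ ν := by
  have hφ := hasDerivAt_id φ
  have hid := hasDerivAt_id ρ
  fin_cases ν
  · refine (pd2_congr (g := fun φ ρ => φ * ρ) (fun φ ρ _ => pd2_zero_Fnls φ ρ) μ hρ).trans ?_
    fin_cases μ
    · exact pd2_zero_eq ((hφ.mul_const ρ).congr_deriv (by simp))
    · exact pd2_one_eq ((hid.const_mul φ).congr_deriv (by simp))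
  · refine (pd2_congr (g := fun φ ρ => φ ^ 2 / 2 + ρ * Real.log ρ - ρ)
      (fun φ ρ h => pd2_one_Fnls φ h) μ hρ).trans ?_
    fin_cases μ
    · exact pd2_zero_eq (((((hφ.pow 2).div_const 2).add_const _).sub_const _).congr_deriv
        (by simp))
    · exact pd2_one_eq ((((hid.mul (Real.hasDerivAt_log hρ.ne')).const_add _).sub
        hid).congr_deriv (by simp [hρ.ne']))

/-- The `φ`-derivative of the Hessian of `Fnls` is `[[0, 1], [1, 0]]`. -/
theorem pd2_zero_pd2_pd2_Fnls (μ ν : Fin 2) (φ : ℝ) {ρ : ℝ} (hρ : 0 < ρ) :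
    pd2 0 (pd2 μ (pd2 ν Fnls)) φ ρ = !![(0 : ℝ), 1; 1, 0] μ ν := by
  refine (pd2_congr (g := fun φ ρ => !![ρ, φ; φ, Real.log ρ] μ ν)
    (fun φ ρ h => pd2_pd2_Fnls μ ν φ h) 0 hρ).trans ?_
  fin_cases μ <;> fin_cases ν <;> simp [pd2]

/-- The `ρ`-derivative of the Hessian of `Fnls` is `[[1, 0], [0, ρ⁻¹]]`. -/
theorem pd2_one_pd2_pd2_Fnls (μ ν : Fin 2) (φ : ℝ) {ρ : ℝ} (hρ : 0 < ρ) :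
    pd2 1 (pd2 μ (pd2 ν Fnls)) φ ρ = !![1, 0; 0, ρ⁻¹] μ ν := by
  refine (pd2_congr (g := fun φ ρ => !![ρ, φ; φ, Real.log ρ] μ ν)
    (fun φ ρ h => pd2_pd2_Fnls μ ν φ h) 1 hρ).trans ?_
  fin_cases μ <;> fin_cases ν <;> simp [pd2]

/-- The intersection form of the NLS Frobenius manifold:
g^{αβ} = Σ_{γ,μ,ν} E^γ η^{αμ} η^{βν} c_{γμν} = [[2, φ], [φ, 2ρ]] on {ρ > 0},
where c_{αβγ} = ∂_α∂_β∂_γ F. -/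
theorem nls_intersection_form (φ ρ : ℝ) (hρ : 0 < ρ) (α β : Fin 2) :
    (∑ γ : Fin 2, ∑ μ : Fin 2, ∑ ν : Fin 2,
        Enls γ φ ρ * ηnls α μ * ηnls β ν * pd2 γ (pd2 μ (pd2 ν Fnls)) φ ρ)
      = !![(2 : ℝ), φ; φ, 2 * ρ] α β := by
  simp only [Fin.sum_univ_two, pd2_zero_pd2_pd2_Fnls _ _ φ hρ, pd2_one_pd2_pd2_Fnls _ _ φ hρ]
  fin_cases α <;> fin_cases β <;> simp [Enls, ηnls, hρ.ne']
end

section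
/- Let ρ ∈ ℂ with ρ ≠ 0, and let A_ρ be the two-dimensional commutative ℂ-algebra with basis e₁, e₂, unit e₁, and multiplication determined by e₂·e₂ = ρ^{−1} e₁ (this is the multiplication with structure constants c^γ_{αβ} = Σ_δ η^{γδ} ∂_α∂_β∂_δ F obtained from the NLS potential F(φ,ρ) = ½φ²ρ + ½ρ² log ρ − ¾ρ² and the metric η = [[0,1],[1,0]]). Then A_ρ contains no nonzero nilpotent element; equivalently, A_ρ is a semisimple Frobenius algebra, isomorphic as a ℂ-algebra to ℂ × ℂ. -/
/-- The tangent algebra of the NLS Frobenius manifold at a point with ρ ≠ 0: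
the two-dimensional commutative ℂ-algebra with basis e₁ = 1, e₂ = root, unit e₁,
and e₂·e₂ = ρ⁻¹·e₁, realized as ℂ[X]/(X² − ρ⁻¹). -/
noncomputable abbrev NLSAlgebra (ρ : ℂ) :=
  AdjoinRoot (Polynomial.X ^ 2 - Polynomial.C ρ⁻¹ : Polynomial ℂ)

open Polynomial in
/-- Adjoining a root of a polynomial with two distinct roots `a`, `b` yields the split algebra
`K × K`, by evaluation at the two roots. -/
theorem AdjoinRoot.nonempty_algEquiv_prod {K : Type*} [Field K] {a b : K} (hab : a ≠ b) :
    Nonempty (AdjoinRoot ((X - C a) * (X - C b) : K[X]) ≃ₐ[K] K × K) := by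
  have key (p : K[X]) : aeval ((a, b) : K × K) p = (p.eval a, p.eval b) := by
    induction p using Polynomial.induction_on' with
    | add p q hp hq => simp [hp, hq]
    | monomial n c => simp [aeval_monomial]
  let φ : AdjoinRoot ((X - C a) * (X - C b) : K[X]) →ₐ[K] K × K :=
    AdjoinRoot.liftAlgHom _ (Algebra.ofId K (K × K)) (a, b) (by simp)
  have hφ (p : K[X]) : φ (AdjoinRoot.mk _ p) = (p.eval a, p.eval b) := by
    rw [← key]
    rfl
  refine ⟨AlgEquiv.ofBijective φ ⟨(injective_iff_map_eq_zero φ).2 fun x hx => ?_, fun y => ?_⟩⟩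
  · obtain ⟨p, rfl⟩ := AdjoinRoot.mk_surjective x
    rw [hφ, Prod.mk_eq_zero] at hx
    rw [AdjoinRoot.mk_eq_zero]
    exact (isCoprime_X_sub_C_of_isUnit_sub (sub_ne_zero.2 hab).isUnit).mul_dvd
      (dvd_iff_isRoot.2 hx.1) (dvd_iff_isRoot.2 hx.2)
  · have h : a - b ≠ 0 := sub_ne_zero.2 hab
    refine ⟨AdjoinRoot.mk _ (C y.2 + C ((y.1 - y.2) / (a - b)) * (X - C b)), ?_⟩
    rw [hφ]
    ext <;> simp [h]

/-- For ρ ≠ 0 the algebra A_ρ contains no nonzero nilpotent element; equivalently, it is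
semisimple, isomorphic as a ℂ-algebra to ℂ × ℂ. -/
theorem nls_algebra_semisimple (ρ : ℂ) (hρ : ρ ≠ 0) :
    (∀ a : NLSAlgebra ρ, (∃ m : ℕ, 2 ≤ m ∧ a ^ m = 0) → a = 0)
    ∧ Nonempty (NLSAlgebra ρ ≃ₐ[ℂ] ℂ × ℂ) := by
  obtain ⟨s, hs⟩ := IsAlgClosed.exists_pow_nat_eq ρ⁻¹ two_pos
  have hs0 : s ≠ 0 := by
    rintro rfl
    exact inv_ne_zero hρ (by simpa using hs.symm)
  have hfac : (Polynomial.X ^ 2 - Polynomial.C ρ⁻¹ : Polynomial ℂ) =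
      (Polynomial.X - Polynomial.C s) * (Polynomial.X - Polynomial.C (-s)) := by
    rw [← hs, Polynomial.C_pow, Polynomial.C_neg]
    ring
  have e : Nonempty (NLSAlgebra ρ ≃ₐ[ℂ] ℂ × ℂ) := by
    unfold NLSAlgebra
    rw [hfac]
    exact AdjoinRoot.nonempty_algEquiv_prod (self_ne_neg.2 hs0)
  refine ⟨?_, e⟩
  rintro a ⟨m, -, ha⟩
  obtain ⟨e⟩ := e
  exact (isReduced_of_injective e e.injective).eq_zero a ⟨m, ha⟩
end
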